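/- Let a > 0 be a real number, let c = exp(iπ/4), and let k be a positive integer. Then ∫₀^π sin(c·a·(π − x)) · sin(kx) dx = (k³ + i·k·a²)/(k⁴ + a⁴) · sin(c·a·π), where the first sine in the integrand and the sine on the right-hand side are the complex sine function. -/

import Mathlib

open Complex

/-- The integrand is, up to the factor `k ^ 2 - b ^ 2`, the derivative of a Wronskian. -/
theorem sq_sub_sq_mul_integral_sin_mul_sin (b : ℂ) (k : ℕ) :
    ((k : ℂ) ^ 2 - b ^ 2) * (∫ x in (0 : ℝ)..Real.pi,
        Complex.sin (b * ((Real.pi : ℂ) - x)) * (Real.sin (k * x) : ℂ))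
      = k * Complex.sin (b * Real.pi) := by
  have hderiv (x : ℝ) : HasDerivAt
      (fun y : ℝ => -b * Complex.cos (b * ((Real.pi : ℂ) - y)) * Complex.sin (k * y)
        - k * Complex.sin (b * ((Real.pi : ℂ) - y)) * Complex.cos (k * y))
      (((k : ℂ) ^ 2 - b ^ 2) *
        (Complex.sin (b * ((Real.pi : ℂ) - x)) * (Real.sin (k * x) : ℂ))) x := by
    have hl : HasDerivAt (fun z : ℂ => b * ((Real.pi : ℂ) - z)) (b * -1) (x : ℂ) :=
      ((hasDerivAt_id' (x : ℂ)).const_sub _).const_mul b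
    have hr : HasDerivAt (fun z : ℂ => (k : ℂ) * z) (k * 1) (x : ℂ) :=
      (hasDerivAt_id' (x : ℂ)).const_mul _
    refine (((hl.ccos.const_mul (-b)).mul hr.csin).sub
      ((hl.csin.const_mul (k : ℂ)).mul hr.ccos)).comp_ofReal.congr_deriv ?_
    push_cast
    ring
  rw [← intervalIntegral.integral_const_mul,
    intervalIntegral.integral_eq_sub_of_hasDerivAt (fun x _ => hderiv x)
      (Continuous.intervalIntegrable (by fun_prop) _ _)]
  simp [Complex.sin_nat_mul_pi]

theorem exp_I_mul_pi_div_four_sq : Complex.exp (Complex.I * Real.pi / 4) ^ 2 = Complex.I := by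
  rw [← Complex.exp_nat_mul]
  refine Eq.trans (congrArg Complex.exp ?_) Complex.exp_pi_div_two_mul_I
  push_cast
  ring

/-- The Fourier coefficient computation in the proof of Lemma expansion-s:
∫₀^π sin(c·a·(π − x))·sin(kx) dx = (k³ + i·k·a²)/(k⁴ + a⁴)·sin(c·a·π),
where c = exp(iπ/4). -/
theorem fourier_coefficient_complex_sine (a : ℝ) (ha : 0 < a) (k : ℕ) (hk : 1 ≤ k) :
    (∫ x in (0:ℝ)..Real.pi,
        Complex.sin (Complex.exp (Complex.I * Real.pi / 4) * a * ((Real.pi : ℂ) - x))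
          * (Real.sin (k * x) : ℂ))
      = (((k:ℂ)^3 + Complex.I * (k:ℂ) * (a:ℂ)^2) / ((k:ℂ)^4 + (a:ℂ)^4))
          * Complex.sin (Complex.exp (Complex.I * Real.pi / 4) * a * Real.pi) := by
  have hsq : (Complex.exp (Complex.I * Real.pi / 4) * a) ^ 2 = Complex.I * (a : ℂ) ^ 2 := by
    rw [mul_pow, exp_I_mul_pi_div_four_sq]
  have hint := sq_sub_sq_mul_integral_sin_mul_sin (Complex.exp (Complex.I * Real.pi / 4) * a) k
  rw [hsq] at hint
  have hden : (k : ℂ) ^ 4 + (a : ℂ) ^ 4 ≠ 0 := by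
    have : (k : ℝ) ^ 4 + a ^ 4 ≠ 0 := by positivity
    exact_mod_cast this
  rw [div_mul_eq_mul_div, eq_div_iff hden]
  linear_combination ((k : ℂ) ^ 2 + Complex.I * (a : ℂ) ^ 2) * hint
    + (a : ℂ) ^ 4 * (∫ x in (0 : ℝ)..Real.pi,
        Complex.sin (Complex.exp (Complex.I * Real.pi / 4) * a * ((Real.pi : ℂ) - x))
          * (Real.sin (k * x) : ℂ)) * Complex.I_sq
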